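/- Let 𝔄 be a unital complex Banach algebra, let H ∈ 𝔄 have spectrum disjoint from ℝ, and let t ∈ [0, 1]. Then the element t·H + (1−t)·pol H has spectrum disjoint from ℝ, and pol(t·H + (1−t)·pol H) = pol H. -/

import Mathlib

/-- The polarization `pol H := (1/(2π)) ∫₀^{2π} ((−sin t)·1 + (cos t)·H)·((cos t)·1 + (sin t)·H)⁻¹ dt`
in a unital complex Banach algebra. -/
noncomputable def pol {𝔄 : Type*} [NormedRing 𝔄] [NormedAlgebra ℂ 𝔄] [CompleteSpace 𝔄]
    (H : 𝔄) : 𝔄 :=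
  (2 * Real.pi)⁻¹ • ∫ t in (0:ℝ)..(2 * Real.pi),
    ((-Real.sin t) • (1 : 𝔄) + (Real.cos t) • H) *
      Ring.inverse ((Real.cos t) • (1 : 𝔄) + (Real.sin t) • H)

open MeasureTheory intervalIntegral

/-- The integrand in the definition of `pol`. -/
noncomputable def polIntegrand {A : Type*} [NormedRing A] [NormedAlgebra ℂ A] (H : A) (t : ℝ) : A :=
  ((-Real.sin t) • (1 : A) + (Real.cos t) • H) *
    Ring.inverse ((Real.cos t) • (1 : A) + (Real.sin t) • H)

section Integrand

variable {A : Type*} [NormedRing A] [NormedAlgebra ℂ A] {H : A}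

theorem isUnit_cos_add_sin_smul (hH : ∀ z ∈ spectrum ℂ H, z.im ≠ 0) (t : ℝ) :
    IsUnit (Real.cos t • (1 : A) + Real.sin t • H) := by
  by_cases hs : Real.sin t = 0
  · have hc : Real.cos t ≠ 0 := by
      intro hc
      have := Real.sin_sq_add_cos_sq t
      simp [hs, hc] at this
    rw [hs, zero_smul, add_zero, Algebra.smul_def, mul_one]
    exact (isUnit_iff_ne_zero.2 hc).map (algebraMap ℝ A)
  · have h : IsUnit (algebraMap ℂ A ((-(Real.cos t / Real.sin t) : ℝ) : ℂ) - H) := by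
      by_contra h
      exact hH _ (spectrum.mem_iff.2 h) (Complex.ofReal_im _)
    have h' := ((isUnit_iff_ne_zero.2 (neg_ne_zero.2 hs)).map (algebraMap ℝ A)).mul h
    convert h' using 1
    have e : algebraMap ℂ A ((-(Real.cos t / Real.sin t) : ℝ) : ℂ) =
        algebraMap ℝ A (-(Real.cos t / Real.sin t)) :=
      (IsScalarTower.algebraMap_apply ℝ ℂ A _).symm
    rw [e, mul_sub, ← map_mul, Algebra.smul_def, Algebra.smul_def, mul_one,
      map_neg _ (Real.sin t), neg_mul (algebraMap ℝ A _), sub_neg_eq_add]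
    congr 2
    field_simp

theorem polIntegrand_periodic (H : A) : Function.Periodic (polIntegrand H) (2 * Real.pi) := by
  intro t
  simp [polIntegrand]

theorem continuous_polIntegrand [CompleteSpace A]
    (hu : ∀ t : ℝ, IsUnit (Real.cos t • (1 : A) + Real.sin t • H)) :
    Continuous (polIntegrand H) := by
  unfold polIntegrand
  refine Continuous.mul (by fun_prop) (continuous_iff_continuousAt.2 fun t => ?_)
  obtain ⟨u, hu⟩ := hu t
  have h1 : ContinuousAt Ring.inverse (Real.cos t • (1 : A) + Real.sin t • H) :=
    hu ▸ NormedRing.inverse_continuousAt u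
  have h2 : ContinuousAt (fun t : ℝ => Real.cos t • (1 : A) + Real.sin t • H) t := by fun_prop
  exact ContinuousAt.comp (f := fun t : ℝ => Real.cos t • (1 : A) + Real.sin t • H) h1 h2

theorem map_pol [CompleteSpace A] {B : Type*} [NormedRing B] [NormedAlgebra ℂ B] [CompleteSpace B]
    (f : A →ₐ[ℂ] B) (hf : Continuous f) (hH : ∀ z ∈ spectrum ℂ H, z.im ≠ 0) :
    f (pol H) = pol (f H) := by
  have hu := isUnit_cos_add_sin_smul hH
  let L : A →L[ℂ] B := ⟨f.toLinearMap, hf⟩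
  have hsmul : ∀ (r : ℝ) (x : A), f (r • x) = r • f x := fun r x => by
    rw [← Complex.coe_smul, map_smul, Complex.coe_smul]
  have h_int : ∀ t, f (polIntegrand H t) = polIntegrand (f H) t := fun t => by
    obtain ⟨u, hu⟩ := hu t
    have e : Real.cos t • (1 : B) + Real.sin t • f H = (Units.map (f : A →* B) u : Bˣ) := by
      simp [hu, hsmul]
    simp only [polIntegrand, map_mul, map_add, hsmul, map_one]
    rw [e, ← hu, Ring.inverse_unit, Ring.inverse_unit]
    simp
  have h := L.intervalIntegral_comp_comm
    ((continuous_polIntegrand hu).intervalIntegrable (μ := volume) 0 (2 * Real.pi))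
  change f ((2 * Real.pi)⁻¹ • ∫ t in (0 : ℝ)..(2 * Real.pi), polIntegrand H t) =
    (2 * Real.pi)⁻¹ • ∫ t in (0 : ℝ)..(2 * Real.pi), polIntegrand (f H) t
  rw [hsmul]
  congr 1
  refine h.symm.trans (integral_congr fun t _ => h_int t)

end Integrand

theorem polIntegrand_im (z : ℂ) (t : ℝ) :
    (polIntegrand z t).im = (Complex.normSq (Real.cos t + Real.sin t * z))⁻¹ * z.im := by
  have h := Real.sin_sq_add_cos_sq t
  rw [polIntegrand, Ring.inverse_eq_inv', Complex.inv_def]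
  simp only [Complex.real_smul, mul_one, Complex.mul_im, Complex.mul_re, Complex.add_re,
    Complex.add_im, Complex.ofReal_re, Complex.ofReal_im, Complex.conj_re, Complex.conj_im]
  linear_combination (Complex.normSq (Real.cos t + Real.sin t * z))⁻¹ * z.im * h

theorem exists_pos_pol_im_eq_mul {z : ℂ} (hz : z.im ≠ 0) :
    ∃ c : ℝ, 0 < c ∧ (pol z).im = c * z.im := by
  have hu : ∀ t : ℝ, IsUnit (Real.cos t • (1 : ℂ) + Real.sin t • z) :=
    isUnit_cos_add_sin_smul (by simpa [spectrum.mem_iff, sub_eq_zero] using hz)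
  have hne : ∀ t : ℝ, (Real.cos t + Real.sin t * z : ℂ) ≠ 0 := fun t => by
    simpa using (hu t).ne_zero
  have hc : Continuous fun t : ℝ => (Complex.normSq (Real.cos t + Real.sin t * z))⁻¹ :=
    (Complex.continuous_normSq.comp (by fun_prop)).inv₀
      fun t => (Complex.normSq_pos.2 (hne t)).ne'
  have h := Complex.imCLM.intervalIntegral_comp_comm
    ((continuous_polIntegrand hu).intervalIntegrable (μ := volume) 0 (2 * Real.pi))
  simp only [Complex.imCLM_apply, polIntegrand_im, intervalIntegral.integral_mul_const] at h
  have hp : 0 < ∫ t in (0 : ℝ)..(2 * Real.pi),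
      (Complex.normSq (Real.cos t + Real.sin t * z))⁻¹ :=
    intervalIntegral_pos_of_pos (hc.intervalIntegrable _ _)
      (fun t => inv_pos.2 (Complex.normSq_pos.2 (hne t))) Real.two_pi_pos
  refine ⟨_, mul_pos (inv_pos.2 Real.two_pi_pos) hp, ?_⟩
  rw [mul_assoc, h]
  exact Complex.smul_im _ _

section Commutative

variable {A : Type*} [NormedCommRing A] [NormedAlgebra ℂ A] {H : A}

theorem sin_smul_polIntegrand_mul
    (hu : ∀ t : ℝ, IsUnit (Real.cos t • (1 : A) + Real.sin t • H)) (t r : ℝ) :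
    Real.sin r • (polIntegrand H t * polIntegrand H (t + r) + 1) =
      Real.cos r • (polIntegrand H t - polIntegrand H (t + r)) := by
  have h1 := Ring.mul_inverse_cancel _ (hu t)
  have h2 := Ring.mul_inverse_cancel _ (hu (t + r))
  unfold polIntegrand
  set x := Ring.inverse (Real.cos t • (1 : A) + Real.sin t • H)
  set y := Ring.inverse (Real.cos (t + r) • (1 : A) + Real.sin (t + r) • H)
  have hsc (a : ℝ) : algebraMap ℝ A (Real.sin a) ^ 2 + algebraMap ℝ A (Real.cos a) ^ 2 = 1 := by
    rw [← map_pow, ← map_pow, ← map_add, Real.sin_sq_add_cos_sq, map_one]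
  refine ((hu t).mul (hu (t + r))).mul_left_cancel ?_
  simp only [Real.cos_add, Real.sin_add, Algebra.smul_def, map_neg, map_add, map_sub, map_mul,
    mul_one] at h1 h2 ⊢
  have ht := hsc t
  have hr := hsc r
  set s := algebraMap ℝ A (Real.sin t)
  set c := algebraMap ℝ A (Real.cos t)
  set p := algebraMap ℝ A (Real.sin r)
  set q := algebraMap ℝ A (Real.cos r)
  set D := c + s * H
  set E := c * q - s * p + (s * q + c * p) * H
  set N := -s + c * H
  set M := -(s * q + c * p) + (c * q - s * p) * H
  have key : p * (N * M + D * E) = q * (N * E - M * D) := by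
    have e1 : N * M + D * E = q * (1 + H ^ 2) := by
      linear_combination q * (1 + H ^ 2) * ht
    have e2 : N * E - M * D = p * (1 + H ^ 2) := by
      linear_combination p * (1 + H ^ 2) * ht
    rw [e1, e2]; ring
  have hl : D * E * (p * (N * x * (M * y) + 1)) = p * (N * M + D * E) := by
    linear_combination p * N * M * (E * y) * h1 + p * N * M * h2
  have hr' : D * E * (q * (N * x - M * y)) = q * (N * E - M * D) := by
    linear_combination q * N * E * h1 - q * M * D * h2
  rw [hl, hr', key]

variable [CompleteSpace A]

theorem integral_polIntegrand_mul_shift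
    (hu : ∀ t : ℝ, IsUnit (Real.cos t • (1 : A) + Real.sin t • H)) {r : ℝ}
    (hr : Real.sin r ≠ 0) :
    ∫ t in (0 : ℝ)..(2 * Real.pi), polIntegrand H t * polIntegrand H (t + r) =
      -((2 * Real.pi) • (1 : A)) := by
  have hc := continuous_polIntegrand hu
  have hc' : Continuous fun t => polIntegrand H (t + r) := by fun_prop
  have e : ∀ t, polIntegrand H t * polIntegrand H (t + r) =
      (Real.cos r / Real.sin r) • (polIntegrand H t - polIntegrand H (t + r)) - 1 := fun t => by
    rw [eq_sub_iff_add_eq, div_eq_inv_mul, mul_smul, ← sin_smul_polIntegrand_mul hu, smul_smul,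
      inv_mul_cancel₀ hr, one_smul]
  have hs : ∫ t in (0 : ℝ)..(2 * Real.pi), polIntegrand H (t + r) =
      ∫ t in (0 : ℝ)..(2 * Real.pi), polIntegrand H t := by
    rw [integral_comp_add_right (polIntegrand H) r]
    simpa [add_comm] using (polIntegrand_periodic H).intervalIntegral_add_eq r 0
  simp_rw [e]
  rw [integral_sub (Continuous.intervalIntegrable (by fun_prop) _ _) intervalIntegrable_const,
    intervalIntegral.integral_smul,
    integral_sub (hc.intervalIntegrable _ _) (hc'.intervalIntegrable _ _), hs,
    intervalIntegral.integral_const]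
  simp

theorem pol_mul_self (hu : ∀ t : ℝ, IsUnit (Real.cos t • (1 : A) + Real.sin t • H)) :
    pol H * pol H = -1 := by
  have hc := continuous_polIntegrand hu
  set I := ∫ t in (0 : ℝ)..(2 * Real.pi), polIntegrand H t with hI
  have hs : ∀ t, ∫ r in (0 : ℝ)..(2 * Real.pi), polIntegrand H (t + r) = I := fun t => by
    rw [integral_comp_add_left (polIntegrand H) t]
    simpa using (polIntegrand_periodic H).intervalIntegral_add_eq t 0
  have h1 : ∫ t in (0 : ℝ)..(2 * Real.pi), ∫ r in (0 : ℝ)..(2 * Real.pi),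
      polIntegrand H t * polIntegrand H (t + r) = I * I := by
    have e (t : ℝ) : ∫ r in (0 : ℝ)..(2 * Real.pi), polIntegrand H t * polIntegrand H (t + r) =
        polIntegrand H t * I := by
      rw [← hs t]
      exact (ContinuousLinearMap.mul ℂ A (polIntegrand H t)).intervalIntegral_comp_comm
        (Continuous.intervalIntegrable (by fun_prop) _ _)
    simp_rw [e]
    exact ((ContinuousLinearMap.mul ℂ A).flip I).intervalIntegral_comp_comm
      (hc.intervalIntegrable _ _)
  have hae : ∀ᵐ r : ℝ, Real.sin r ≠ 0 := by
    have : {r : ℝ | Real.sin r = 0}.Countable :=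
      (Set.countable_range fun n : ℤ => (n : ℝ) * Real.pi).mono
        fun r hr => Real.sin_eq_zero_iff.1 hr
    simpa [ae_iff] using this.measure_zero volume
  have h2 : I * I = (2 * Real.pi) • -((2 * Real.pi) • (1 : A)) := by
    have h_int : Continuous (Function.uncurry fun t r =>
        polIntegrand H t * polIntegrand H (t + r)) := by
      unfold Function.uncurry
      fun_prop
    rw [← h1, intervalIntegral_intervalIntegral_swap
      ((h_int.continuousOn.integrableOn_compact (isCompact_uIcc.prod isCompact_uIcc)).mono_set
        (Set.prod_mono Set.uIoc_subset_uIcc Set.uIoc_subset_uIcc)),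
      integral_congr_ae (g := fun _ => -((2 * Real.pi) • (1 : A)))
        (hae.mono fun r hr _ => integral_polIntegrand_mul_shift hu hr)]
    simp
  have hp : pol H = (2 * Real.pi)⁻¹ • I := rfl
  have hpi : (2 * Real.pi) ≠ 0 := Real.two_pi_pos.ne'
  rw [hp, smul_mul_smul_comm, h2, smul_neg, smul_smul, smul_neg, smul_smul]
  rw [show (2 * Real.pi)⁻¹ * (2 * Real.pi)⁻¹ * (2 * Real.pi * (2 * Real.pi)) = 1 by field_simp,
    one_smul]

theorem exists_pos_character_pol_im (hH : ∀ z ∈ spectrum ℂ H, z.im ≠ 0)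
    (φ : WeakDual.characterSpace ℂ A) :
    ∃ c : ℝ, 0 < c ∧ (φ (pol H)).im = c * (φ H).im := by
  have h := map_pol (WeakDual.CharacterSpace.toAlgHom φ) (map_continuous φ) hH
  obtain ⟨c, hc, e⟩ := exists_pos_pol_im_eq_mul (hH _ (AlgHom.apply_mem_spectrum φ H))
  exact ⟨c, hc, (congrArg Complex.im h).trans e⟩

theorem pol_convex_combination_of_comm (hH : ∀ z ∈ spectrum ℂ H, z.im ≠ 0)
    {t : ℝ} (ht0 : 0 ≤ t) (ht1 : t ≤ 1) :
    (∀ z ∈ spectrum ℂ (t • H + (1 - t) • pol H), z.im ≠ 0) ∧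
      pol (t • H + (1 - t) • pol H) = pol H := by
  set K := t • H + (1 - t) • pol H with hK
  have hφ : ∀ φ : WeakDual.characterSpace ℂ A, ∃ c : ℝ, 0 < c ∧ (φ K).im = c * (φ H).im := by
    intro φ
    obtain ⟨c, hc, e⟩ := exists_pos_character_pol_im hH φ
    refine ⟨t + (1 - t) * c, ?_, ?_⟩
    · rcases ht1.eq_or_lt with rfl | h
      · simp
      · have := mul_pos (sub_pos.2 h) hc
        positivity
    · rw [hK, ← Complex.coe_smul, ← Complex.coe_smul, map_add, map_smul, map_smul]
      simp only [smul_eq_mul, Complex.add_im, Complex.im_ofReal_mul, e]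
      ring
  have hKs : ∀ z ∈ spectrum ℂ K, z.im ≠ 0 := by
    intro z hz
    obtain ⟨φ, rfl⟩ := WeakDual.CharacterSpace.mem_spectrum_iff_exists.1 hz
    obtain ⟨c, hc, e⟩ := hφ φ
    rw [e]
    exact mul_ne_zero hc.ne' (hH _ (AlgHom.apply_mem_spectrum φ H))
  refine ⟨hKs, ?_⟩
  have hu : IsUnit (pol K + pol H) := by
    by_contra h
    obtain ⟨φ, h0⟩ := WeakDual.CharacterSpace.exists_apply_eq_zero h
    obtain ⟨a, ha, ea⟩ := hφ φ
    obtain ⟨b, hb, eb⟩ := exists_pos_character_pol_im hH φ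
    obtain ⟨c, hc, ec⟩ := exists_pos_character_pol_im hKs φ
    have h1 : (c * a + b) * (φ H).im = 0 := by
      have := congrArg Complex.im h0
      rw [map_add, Complex.add_im, ec, eb, ea, Complex.zero_im] at this
      linear_combination this
    exact mul_ne_zero (by positivity) (hH _ (AlgHom.apply_mem_spectrum φ H)) h1
  refine sub_eq_zero.1 (hu.mul_left_cancel ?_)
  linear_combination pol_mul_self (isUnit_cos_add_sin_smul hKs) -
    pol_mul_self (isUnit_cos_add_sin_smul hH)

end Commutative

theorem Subalgebra.isUnit_of_isUnit_coe_centralizer {R A : Type*} [CommSemiring R] [Ring A]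
    [Algebra R A] {s : Set A} {x : Subalgebra.centralizer R s} (hx : IsUnit (x : A)) :
    IsUnit x := by
  obtain ⟨u, hu⟩ := hx
  have hmem : (↑u⁻¹ : A) ∈ Subalgebra.centralizer R s := by
    rw [Subalgebra.mem_centralizer_iff]
    intro g hg
    have h : Commute g (u : A) := by
      rw [hu]
      exact (Subalgebra.mem_centralizer_iff R).1 x.2 g hg
    exact h.units_inv_right
  exact ⟨⟨x, ⟨_, hmem⟩, Subtype.ext (by simp [← hu]), Subtype.ext (by simp [← hu])⟩, rfl⟩

theorem stmt8 {𝔄 : Type*} [NormedRing 𝔄] [NormedAlgebra ℂ 𝔄] [CompleteSpace 𝔄]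
    (H : 𝔄) (hH : ∀ z ∈ spectrum ℂ H, z.im ≠ 0)
    (t : ℝ) (ht0 : 0 ≤ t) (ht1 : t ≤ 1) :
    (∀ z ∈ spectrum ℂ (t • H + (1 - t) • pol H), z.im ≠ 0) ∧
    pol (t • H + (1 - t) • pol H) = pol H := by
  let S : Subalgebra ℂ 𝔄 := Subalgebra.centralizer ℂ (Set.centralizer {H})
  have hcl : IsClosed (S : Set 𝔄) := Set.isClosed_centralizer _
  have : CompleteSpace S := hcl.completeSpace_coe
  let h : S := ⟨H, Set.subset_centralizer_centralizer (Set.mem_singleton H)⟩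
  have hh : ∀ z ∈ spectrum ℂ h, z.im ≠ 0 := fun z hz =>
    hH z fun hu => hz (Subalgebra.isUnit_of_isUnit_coe_centralizer hu)
  let instS : NormedCommRing S :=
    { (inferInstance : NormedRing S) with
      mul_comm := fun x y => Subtype.ext <|
        Set.centralizer_centralizer_comm_of_comm (by simp) _ x.2 _ y.2 }
  obtain ⟨h1, h2⟩ := pol_convex_combination_of_comm (A := S) (H := h) hh ht0 ht1
  have e : ((pol h : S) : 𝔄) = pol H := map_pol S.val continuous_subtype_val hh
  have eK : ((t • h + (1 - t) • pol h : S) : 𝔄) = t • H + (1 - t) • pol H := by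
    rw [← e]; rfl
  rw [← eK]
  refine ⟨fun z hz => h1 z (AlgHom.spectrum_apply_subset S.val _ hz), ?_⟩
  have e2 := map_pol S.val continuous_subtype_val h1
  exact e2.symm.trans ((congrArg Subtype.val h2).trans e)
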